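/- In the interpolating Wigner spike model (prior P_0 supported on [-S,S], time t∈[0,1], SNR R_ε(t)>0), let Q = (1/n)Σ_{i=1}^n x_iX_i and L = (1/n)Σ_{i=1}^n( x_i²/2 - x_iX_i - x_iZ̃_i/(2√R_ε(t)) ). Then -2 E⟨Q(L - E⟨L⟩_{t,ε})⟩_{t,ε} = E⟨(Q - E⟨Q⟩_{t,ε})²⟩_{t,ε} + E⟨(Q - ⟨Q⟩_{t,ε})²⟩_{t,ε}. -/

import Mathlib

open Finset MeasureTheory ProbabilityTheory

/-- The standard Gaussian measure `N(0,1)` on `ℝ`. -/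
noncomputable def stdGauss : Measure ℝ := gaussianReal 0 1

instance : IsProbabilityMeasure stdGauss :=
  inferInstanceAs (IsProbabilityMeasure (gaussianReal 0 1))

/-- Interpolating Hamiltonian of the Wigner spike model:
`H_{t,R}(x;X,Z,Z̃) = (1-t)Σ_{i≤j}( x_i²x_j²/(2n) - x_ix_jX_iX_j/n - x_ix_jZ_ij/√(n(1-t)) )
  + R Σ_i ( x_i²/2 - x_iX_i - x_iZ̃_i/√R )`. -/
noncomputable def Hint (n : ℕ) (t R : ℝ) (X : Fin n → ℝ) (Z : Fin n × Fin n → ℝ)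
    (Zt : Fin n → ℝ) (x : Fin n → ℝ) : ℝ :=
  (1 - t) * ∑ i : Fin n, ∑ j ∈ Finset.univ.filter (fun j => i ≤ j),
      (x i ^ 2 * x j ^ 2 / (2 * n) - x i * x j * X i * X j / n
        - x i * x j * Z (i, j) / Real.sqrt (n * (1 - t)))
    + R * ∑ i : Fin n, (x i ^ 2 / 2 - x i * X i - x i * Zt i / Real.sqrt R)

/-- Gibbs expectation `⟨A⟩_{t,R}` under the interpolating posterior, proportional to
`∏_i dP_0(x_i) e^{-H_{t,R}(x;X,Z,Z̃)}`. -/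
noncomputable def gibbsWS (P0 : Measure ℝ) (n : ℕ) (t R : ℝ) (X : Fin n → ℝ)
    (Z : Fin n × Fin n → ℝ) (Zt : Fin n → ℝ) (A : (Fin n → ℝ) → ℝ) : ℝ :=
  (∫ x : Fin n → ℝ, A x * Real.exp (-Hint n t R X Z Zt x)
      ∂(Measure.pi fun _ : Fin n => P0)) /
  (∫ x : Fin n → ℝ, Real.exp (-Hint n t R X Z Zt x)
      ∂(Measure.pi fun _ : Fin n => P0))

/-- Quenched expectation `E` over `X ∼ P_0^{⊗n}`, `Z ∼ N(0,1)^{⊗n×n}`,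
`Z̃ ∼ N(0,1)^{⊗n}`. -/
noncomputable def EWS (P0 : Measure ℝ) (n : ℕ)
    (F : (Fin n → ℝ) → (Fin n × Fin n → ℝ) → (Fin n → ℝ) → ℝ) : ℝ :=
  ∫ X : Fin n → ℝ,
    (∫ Z : Fin n × Fin n → ℝ,
      (∫ Zt : Fin n → ℝ, F X Z Zt ∂(Measure.pi fun _ : Fin n => stdGauss))
      ∂(Measure.pi fun _ : Fin n × Fin n => stdGauss))
    ∂(Measure.pi fun _ : Fin n => P0)

/-- `L = (1/n) Σ_i ( x_i²/2 - x_iX_i - x_iZ̃_i/(2√R) )`. -/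
noncomputable def Lws (n : ℕ) (R : ℝ) (X Zt x : Fin n → ℝ) : ℝ :=
  (1 / n) * ∑ i : Fin n, (x i ^ 2 / 2 - x i * X i - x i * Zt i / (2 * Real.sqrt R))

/-- The overlap `Q = (1/n) Σ_i x_iX_i`. -/
noncomputable def Qws (n : ℕ) (x X : Fin n → ℝ) : ℝ :=
  (1 / n) * ∑ i : Fin n, x i * X i

/-- Quenched Gibbs average `E⟨L⟩_{t,R}`. -/
noncomputable def ELws (P0 : Measure ℝ) (n : ℕ) (t R : ℝ) : ℝ :=
  EWS P0 n (fun X Z Zt => gibbsWS P0 n t R X Z Zt (fun x => Lws n R X Zt x))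

/-- Quenched Gibbs average `E⟨Q⟩_{t,R}`. -/
noncomputable def EQws (P0 : Measure ℝ) (n : ℕ) (t R : ℝ) : ℝ :=
  EWS P0 n (fun X Z Zt => gibbsWS P0 n t R X Z Zt (fun x => Qws n x X))

/-- The standard Gaussian measure on `ι → ℝ`. -/
noncomputable abbrev stdGaussPi (ι : Type*) [Fintype ι] : Measure (ι → ℝ) :=
  Measure.pi fun _ : ι => stdGauss

/-- Likelihood ratio at the observation `y` of a Gaussian channel with signal `c`. -/
noncomputable def gaussLR {ι : Type*} [Fintype ι] (c y : ι → ℝ) : ℝ :=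
  Real.exp (∑ k, (c k * y k - c k ^ 2 / 2))

lemma gaussLR_pos {ι : Type*} [Fintype ι] (c y : ι → ℝ) : 0 < gaussLR c y := Real.exp_pos _

lemma gaussianReal_eq_withDensity_stdGauss (c : ℝ) :
    gaussianReal c 1
      = stdGauss.withDensity fun y => ENNReal.ofReal (Real.exp (c * y - c ^ 2 / 2)) := by
  rw [stdGauss, gaussianReal_of_var_ne_zero _ one_ne_zero,
    gaussianReal_of_var_ne_zero _ one_ne_zero,
    ← withDensity_mul _ (measurable_gaussianPDF _ _) (by fun_prop)]
  congr 1
  ext y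
  rw [Pi.mul_apply, gaussianPDF, gaussianPDF,
    ← ENNReal.ofReal_mul (gaussianPDFReal_nonneg _ _ _)]
  congr 1
  rw [gaussianPDFReal, gaussianPDFReal, mul_assoc _⁻¹ (Real.exp _) (Real.exp _), ← Real.exp_add]
  congr 2
  push_cast
  ring

section GaussianShift

variable {ι : Type*} [Fintype ι]

lemma map_const_add_stdGaussPi (c : ι → ℝ) :
    (stdGaussPi ι).map (fun y => c + y)
      = (stdGaussPi ι).withDensity fun y => ENNReal.ofReal (gaussLR c y) := by
  have h1 : (stdGaussPi ι).map (fun y => c + y) = Measure.pi fun i => gaussianReal (c i) 1 := by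
    have hmap : ∀ i, stdGauss.map (fun y => c i + y) = gaussianReal (c i) 1 := fun i => by
      rw [stdGauss, gaussianReal_map_const_add, zero_add]
    have : ∀ i, SigmaFinite (stdGauss.map (fun y => c i + y)) := fun i => by
      rw [hmap]; infer_instance
    have h := Measure.pi_map_pi (μ := fun _ : ι => stdGauss) (f := fun i y => c i + y)
      (fun i => (by fun_prop))
    simp_rw [hmap] at h
    exact h
  rw [h1]
  refine Measure.pi_eq fun s hs => ?_
  rw [withDensity_apply _ (MeasurableSet.univ_pi hs),
    ← lintegral_indicator (MeasurableSet.univ_pi hs)]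
  set X : ι → ℝ → ENNReal := fun i =>
    (s i).indicator fun y => ENNReal.ofReal (Real.exp (c i * y - c i ^ 2 / 2))
  have hX : ∀ i, Measurable (X i) := fun i => Measurable.indicator (by fun_prop) (hs i)
  have hprod : (Set.univ.pi s).indicator (fun y => ENNReal.ofReal (gaussLR c y))
      = fun y => ∏ i, X i (y i) := by
    ext y
    by_cases hy : y ∈ Set.univ.pi s
    · rw [Set.indicator_of_mem hy, gaussLR, Real.exp_sum,
        ENNReal.ofReal_prod_of_nonneg fun i _ => (Real.exp_pos _).le]
      refine Finset.prod_congr rfl fun i _ => ?_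
      simp only [X]
      rw [Set.indicator_of_mem (hy i (Set.mem_univ i))]
    · rw [Set.indicator_of_notMem hy]
      simp only [Set.mem_pi, Set.mem_univ, true_implies, not_forall] at hy
      obtain ⟨i, hi⟩ := hy
      exact (Finset.prod_eq_zero (Finset.mem_univ i) (Set.indicator_of_notMem hi _)).symm
  rw [hprod, lintegral_prod_eq_prod_lintegral_of_indepFun Finset.univ
    (fun i (y : ι → ℝ) => X i (y i))
    (iIndepFun_pi fun i => (hX i).aemeasurable)
    (fun i => (hX i).comp (measurable_pi_apply i))]
  refine Finset.prod_congr rfl fun i _ => ?_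
  rw [(measurePreserving_eval (fun _ : ι => stdGauss) i).lintegral_comp (hX i),
    lintegral_indicator (hs i), gaussianReal_eq_withDensity_stdGauss, withDensity_apply _ (hs i)]

@[fun_prop]
lemma measurable_gaussLR {α : Type*} [MeasurableSpace α] {c y : α → ι → ℝ}
    (hc : Measurable c) (hy : Measurable y) : Measurable fun a => gaussLR (c a) (y a) := by
  unfold gaussLR
  fun_prop

/-- Cameron–Martin formula for the standard Gaussian measure on `ι → ℝ`. -/
lemma integral_const_add_stdGaussPi {f : (ι → ℝ) → ℝ} (hf : Measurable f) (c : ι → ℝ) :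
    ∫ y, f (c + y) ∂stdGaussPi ι = ∫ y, f y * gaussLR c y ∂stdGaussPi ι := by
  rw [← integral_map (φ := fun y => c + y) (by fun_prop) hf.aestronglyMeasurable,
    map_const_add_stdGaussPi, integral_withDensity_eq_integral_toReal_smul (by fun_prop) (by simp)]
  simp [ENNReal.toReal_ofReal (gaussLR_pos _ _).le, mul_comm]

lemma integrable_gaussLR (c : ι → ℝ) : Integrable (gaussLR c) (stdGaussPi ι) := by
  have h : IsProbabilityMeasure
      ((stdGaussPi ι).withDensity fun y => ENNReal.ofReal (gaussLR c y)) := by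
    rw [← map_const_add_stdGaussPi]
    exact Measure.isProbabilityMeasure_map (by fun_prop)
  refine (lintegral_ofReal_ne_top_iff_integrable (by fun_prop)
    (Filter.Eventually.of_forall fun y => (gaussLR_pos c y).le)).1 ?_
  rw [← setLIntegral_univ, ← withDensity_apply _ MeasurableSet.univ]
  exact measure_ne_top _ _

lemma integral_gaussLR (c : ι → ℝ) : ∫ y, gaussLR c y ∂stdGaussPi ι = 1 := by
  simpa using (integral_const_add_stdGaussPi (f := fun _ => (1 : ℝ)) measurable_const c).symm

lemma integrable_eval_stdGaussPi (k : ι) : Integrable (fun y : ι → ℝ => y k) (stdGaussPi ι) :=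
  integrable_eval ((memLp_id_gaussianReal' 1 (by simp)).integrable le_rfl)

lemma abs_mul_exp_mul_sub_sq_le {s y : ℝ} (hs : |s| ≤ 1) :
    |(y - s) * Real.exp (s * y - s ^ 2 / 2)| ≤ Real.exp (2 * y) + Real.exp (-2 * y) := by
  have h1 : |y - s| ≤ Real.exp |y| := by
    have := Real.add_one_le_exp |y|
    have := abs_sub y s
    linarith
  have h2 : Real.exp (s * y - s ^ 2 / 2) ≤ Real.exp |y| := by
    apply Real.exp_le_exp.2
    have := le_abs_self (s * y)
    rw [abs_mul] at this
    nlinarith [abs_nonneg y, sq_nonneg s]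
  rw [abs_mul, abs_of_pos (Real.exp_pos _)]
  calc _ ≤ Real.exp |y| * Real.exp |y| := by gcongr
    _ = Real.exp (2 * |y|) := by rw [← Real.exp_add]; ring_nf
    _ ≤ _ := by
      rcases abs_cases y with ⟨h, -⟩ | ⟨h, -⟩ <;> rw [h]
      · linarith [Real.exp_pos (-2 * y)]
      · rw [mul_neg, ← neg_mul]; linarith [Real.exp_pos (2 * y)]

/-- Gaussian integration by parts (Stein's lemma) along the coordinate `k`. -/
lemma integral_eval_mul_stdGaussPi [DecidableEq ι] {f f' : (ι → ℝ) → ℝ} (k : ι)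
    (hf : Measurable f) (hf' : Measurable f') {C C' : ℝ} (hC : ∀ y, |f y| ≤ C)
    (hC' : ∀ y, |f' y| ≤ C')
    (hd : ∀ y, HasDerivAt (fun s => f (Pi.single k s + y)) (f' y) 0) :
    ∫ y, y k * f y ∂stdGaussPi ι = ∫ y, f' y ∂stdGaussPi ι := by
  have hd' : ∀ (y : ι → ℝ) (s : ℝ),
      HasDerivAt (fun s => f (Pi.single k s + y)) (f' (Pi.single k s + y)) s := by
    intro y s
    have h := (hd (Pi.single k s + y))
    rw [← sub_self s] at h
    have hs := h.comp_sub_const s s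
    simp_rw [← add_assoc, ← Pi.single_add, sub_add_cancel] at hs
    exact hs
  have hmem : Metric.closedBall (0 : ℝ) 1 ∈ nhds (0 : ℝ) := Metric.closedBall_mem_nhds _ one_pos
  have hmeas : ∀ {g : (ι → ℝ) → ℝ}, Measurable g → ∀ s : ℝ,
      Measurable fun y : ι → ℝ => g (Pi.single k s + y) := fun hg s => by fun_prop
  have h1 : HasDerivAt (fun s => ∫ y, f (Pi.single k s + y) ∂stdGaussPi ι)
      (∫ y, f' y ∂stdGaussPi ι) 0 := by
    have := (hasDerivAt_integral_of_dominated_loc_of_deriv_le (μ := stdGaussPi ι)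
      (F := fun s (y : ι → ℝ) => f (Pi.single k s + y))
      (F' := fun s (y : ι → ℝ) => f' (Pi.single k s + y))
      (x₀ := (0 : ℝ)) (bound := fun _ => C') hmem
      (Filter.Eventually.of_forall fun s => (hmeas hf s).aestronglyMeasurable)
      (Integrable.of_bound (hmeas hf 0).aestronglyMeasurable C
        (Filter.Eventually.of_forall fun y => hC _))
      (hmeas hf' 0).aestronglyMeasurable
      (Filter.Eventually.of_forall fun y s _ => hC' _) (integrable_const _)
      (Filter.Eventually.of_forall fun y s _ => hd' y s)).2
    simpa using this
  have hexp : ∀ r : ℝ, Integrable (fun y : ι → ℝ => Real.exp (r * y k)) (stdGaussPi ι) := fun r =>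
    integrable_comp_eval (μ := fun _ : ι => stdGauss) (f := fun y => Real.exp (r * y))
      (integrable_exp_mul_gaussianReal r)
  have h2 : HasDerivAt (fun s => ∫ y, f y * Real.exp (s * y k - s ^ 2 / 2) ∂stdGaussPi ι)
      (∫ y, y k * f y ∂stdGaussPi ι) 0 := by
    have := (hasDerivAt_integral_of_dominated_loc_of_deriv_le (μ := stdGaussPi ι)
      (F := fun s (y : ι → ℝ) => f y * Real.exp (s * y k - s ^ 2 / 2))
      (F' := fun s (y : ι → ℝ) => f y * ((y k - s) * Real.exp (s * y k - s ^ 2 / 2)))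
      (x₀ := (0 : ℝ)) (bound := fun y => C * (Real.exp (2 * y k) + Real.exp (-2 * y k))) hmem
      (Filter.Eventually.of_forall fun s => by fun_prop)
      (Integrable.of_bound (by fun_prop) C
        (Filter.Eventually.of_forall fun y => by simpa using hC y))
      (by fun_prop)
      (Filter.Eventually.of_forall fun y s hs => by
        rw [Real.norm_eq_abs, abs_mul]
        have hs' : |s| ≤ 1 := by simpa using hs
        exact mul_le_mul (hC y) (abs_mul_exp_mul_sub_sq_le hs') (abs_nonneg _)
          ((abs_nonneg _).trans (hC y)))
      (((hexp 2).add (hexp (-2))).const_mul C)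
      (Filter.Eventually.of_forall fun y s _ => by
        have hl : HasDerivAt (fun s => s * y k - s ^ 2 / 2) (y k - s) s := by
          refine (((hasDerivAt_id s).mul_const (y k)).sub
            (((hasDerivAt_id s).pow 2).div_const 2)).congr_deriv ?_
          simp
        simpa [mul_comm] using (hl.exp.const_mul (f y)))).2
    simpa [mul_comm] using this
  have heq : (fun s => ∫ y, f (Pi.single k s + y) ∂stdGaussPi ι)
      = fun s => ∫ y, f y * Real.exp (s * y k - s ^ 2 / 2) ∂stdGaussPi ι := by
    ext s
    rw [integral_const_add_stdGaussPi hf]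
    refine integral_congr_ae (Filter.Eventually.of_forall fun y => ?_)
    simp only [gaussLR]
    rw [Finset.sum_eq_single k] <;> simp +contextual
  rw [heq] at h1
  exact h2.unique h1

end GaussianShift

lemma exists_ae_abs_le_of_memLp_top {α : Type*} [MeasurableSpace α] {μ : Measure α} {f : α → ℝ}
    (hf : MemLp f ⊤ μ) : ∃ C, 0 ≤ C ∧ ∀ᵐ x ∂μ, |f x| ≤ C := by
  have hlt : eLpNormEssSup f μ ≠ ⊤ := by simpa using hf.2.ne
  refine ⟨(eLpNormEssSup f μ).toReal, ENNReal.toReal_nonneg, ?_⟩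
  filter_upwards [ae_le_eLpNormEssSup (f := f) (μ := μ)] with x hx
  rw [← Real.norm_eq_abs, ← toReal_enorm]
  exact ENNReal.toReal_mono hlt hx

lemma memLp_top_mul {α : Type*} [MeasurableSpace α] {μ : Measure α} {f g : α → ℝ}
    (hf : MemLp f ⊤ μ) (hg : MemLp g ⊤ μ) : MemLp (fun x => f x * g x) ⊤ μ :=
  hg.mul' hf

lemma memLp_top_add {α : Type*} [MeasurableSpace α] {μ : Measure α} {f g : α → ℝ}
    (hf : MemLp f ⊤ μ) (hg : MemLp g ⊤ μ) : MemLp (fun x => f x + g x) ⊤ μ :=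
  hf.add hg

lemma exists_abs_mul_le {α : Type*} {f g : α → ℝ} (hf : ∃ C, ∀ y, |f y| ≤ C)
    (hg : ∃ C, ∀ y, |g y| ≤ C) : ∃ C, ∀ y, |f y * g y| ≤ C := by
  obtain ⟨C, hC⟩ := hf
  obtain ⟨D, hD⟩ := hg
  refine ⟨C * D, fun y => ?_⟩
  rw [abs_mul]
  exact mul_le_mul (hC y) (hD y) (abs_nonneg _) ((abs_nonneg _).trans (hC y))

section Posterior

variable {Ω : Type*} [MeasurableSpace Ω] {ι : Type*} [Fintype ι]

/-- Posterior mean of `A` given the observation `y` of the signal `φ x`, `x ∼ μ`, through a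
standard Gaussian channel. -/
noncomputable def postMean (μ : Measure Ω) (φ : Ω → ι → ℝ) (A : Ω → ℝ) (y : ι → ℝ) : ℝ :=
  (∫ x, A x * gaussLR (φ x) y ∂μ) / ∫ x, gaussLR (φ x) y ∂μ

variable {μ : Measure Ω} {φ : Ω → ι → ℝ}

lemma postMean_const_mul (c : ℝ) (A : Ω → ℝ) (y : ι → ℝ) :
    postMean μ φ (fun x => c * A x) y = c * postMean μ φ A y := by
  simp only [postMean, mul_assoc]
  rw [integral_const_mul, mul_div_assoc]

/-- Law of the pair (signal, noise). -/
noncomputable abbrev signalNoise (μ : Measure Ω) (ι : Type*) [Fintype ι] : Measure (Ω × (ι → ℝ)) :=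
  μ.prod (stdGaussPi ι)

lemma memLp_top_comp_fst {a : Ω → ℝ} (ha : MemLp a ⊤ μ) :
    MemLp (fun p : Ω × (ι → ℝ) => a p.1) ⊤ (signalNoise μ ι) :=
  ha.comp_measurePreserving measurePreserving_fst

lemma memLp_top_gaussLR (hφ : Measurable φ) (hb : ∀ k, MemLp (fun x => φ x k) ⊤ μ) (y : ι → ℝ) :
    MemLp (fun x => gaussLR (φ x) y) ⊤ μ := by
  choose B _ hB using fun k => exists_ae_abs_le_of_memLp_top (hb k)
  refine memLp_top_of_bound (Measurable.aestronglyMeasurable (by fun_prop))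
    (Real.exp (∑ k, B k * |y k|)) ?_
  filter_upwards [ae_all_iff.2 hB] with x hx
  rw [Real.norm_eq_abs, abs_of_pos (gaussLR_pos _ _), gaussLR]
  gcongr with k _
  have h1 := le_abs_self (φ x k * y k)
  rw [abs_mul] at h1
  nlinarith [sq_nonneg (φ x k), mul_le_mul_of_nonneg_right (hx k) (abs_nonneg (y k))]

variable [IsProbabilityMeasure μ]

lemma integrable_mul_gaussLR (hφ : Measurable φ) (hb : ∀ k, MemLp (fun x => φ x k) ⊤ μ)
    {A : Ω → ℝ} (hA : MemLp A ⊤ μ) (y : ι → ℝ) :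
    Integrable (fun x => A x * gaussLR (φ x) y) μ :=
  (memLp_top_mul hA (memLp_top_gaussLR hφ hb y)).integrable le_top

lemma integral_gaussLR_signal_pos (hφ : Measurable φ) (hb : ∀ k, MemLp (fun x => φ x k) ⊤ μ)
    (y : ι → ℝ) : 0 < ∫ x, gaussLR (φ x) y ∂μ := by
  rw [integral_pos_iff_support_of_nonneg (fun x => (gaussLR_pos _ _).le)
    ((memLp_top_gaussLR hφ hb y).integrable le_top)]
  have : Function.support (fun x => gaussLR (φ x) y) = Set.univ :=
    Set.eq_univ_of_forall fun x => (gaussLR_pos _ _).ne'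
  simp [this]

lemma abs_postMean_le (hφ : Measurable φ) (hb : ∀ k, MemLp (fun x => φ x k) ⊤ μ)
    {A : Ω → ℝ} {C : ℝ} (hC : ∀ᵐ x ∂μ, |A x| ≤ C) (y : ι → ℝ) : |postMean μ φ A y| ≤ C := by
  have hpos := integral_gaussLR_signal_pos hφ hb y
  rw [postMean, abs_div, abs_of_pos hpos, div_le_iff₀ hpos, ← integral_const_mul]
  rw [← Real.norm_eq_abs]
  refine norm_integral_le_of_norm_le
    (((memLp_top_gaussLR hφ hb y).integrable le_top).const_mul C) ?_
  filter_upwards [hC] with x hx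
  rw [Real.norm_eq_abs, abs_mul, abs_of_pos (gaussLR_pos _ _)]
  exact mul_le_mul_of_nonneg_right hx (gaussLR_pos _ _).le

lemma exists_abs_postMean_le (hφ : Measurable φ) (hb : ∀ k, MemLp (fun x => φ x k) ⊤ μ)
    {A : Ω → ℝ} (hA : MemLp A ⊤ μ) : ∃ C, ∀ y, |postMean μ φ A y| ≤ C := by
  obtain ⟨C, -, hC⟩ := exists_ae_abs_le_of_memLp_top hA
  exact ⟨C, abs_postMean_le hφ hb hC⟩

lemma measurable_postMean (hφ : Measurable φ) {A : Ω → ℝ} (hA : Measurable A) :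
    Measurable (postMean μ φ A) := by
  unfold postMean
  refine Measurable.div ?_ ?_
  · exact (StronglyMeasurable.integral_prod_right (f := fun y x => A x * gaussLR (φ x) y)
      (by unfold Function.uncurry; fun_prop : Measurable _).stronglyMeasurable).measurable
  · exact (StronglyMeasurable.integral_prod_right (f := fun y x => gaussLR (φ x) y)
      (by unfold Function.uncurry; fun_prop : Measurable _).stronglyMeasurable).measurable

lemma postMean_add (hφ : Measurable φ) (hb : ∀ k, MemLp (fun x => φ x k) ⊤ μ) {A A' : Ω → ℝ}
    (hA : MemLp A ⊤ μ) (hA' : MemLp A' ⊤ μ) (y : ι → ℝ) :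
    postMean μ φ (fun x => A x + A' x) y = postMean μ φ A y + postMean μ φ A' y := by
  simp only [postMean, add_mul]
  rw [integral_add (integrable_mul_gaussLR hφ hb hA y) (integrable_mul_gaussLR hφ hb hA' y),
    add_div]

lemma postMean_const (hφ : Measurable φ) (hb : ∀ k, MemLp (fun x => φ x k) ⊤ μ) (c : ℝ)
    (y : ι → ℝ) : postMean μ φ (fun _ => c) y = c := by
  rw [postMean, integral_const_mul, mul_div_assoc,
    div_self (integral_gaussLR_signal_pos hφ hb y).ne', mul_one]

lemma postMean_sum (hφ : Measurable φ) (hb : ∀ k, MemLp (fun x => φ x k) ⊤ μ) {κ : Type*}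
    (s : Finset κ) {A : κ → Ω → ℝ} (hA : ∀ i, MemLp (A i) ⊤ μ) (y : ι → ℝ) :
    postMean μ φ (fun x => ∑ i ∈ s, A i x) y = ∑ i ∈ s, postMean μ φ (A i) y := by
  simp only [postMean, Finset.sum_mul]
  rw [integral_finsetSum _ fun i _ => integrable_mul_gaussLR hφ hb (hA i) y, Finset.sum_div]

lemma gaussLR_single_add [DecidableEq ι] (c y : ι → ℝ) (k : ι) (s : ℝ) :
    gaussLR c (Pi.single k s + y) = gaussLR c y * Real.exp (s * c k) := by
  rw [gaussLR, gaussLR, ← Real.exp_add]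
  congr 1
  have : ∑ i, c i * (Pi.single k s : ι → ℝ) i = s * c k := by
    rw [Finset.sum_eq_single k] <;> simp +contextual [mul_comm]
  rw [← this, ← Finset.sum_add_distrib]
  exact Finset.sum_congr rfl fun i _ => by rw [Pi.add_apply]; ring

lemma hasDerivAt_integral_mul_gaussLR [DecidableEq ι] (hφ : Measurable φ)
    (hb : ∀ k, MemLp (fun x => φ x k) ⊤ μ) {A : Ω → ℝ} (hA : MemLp A ⊤ μ) (y : ι → ℝ) (k : ι) :
    HasDerivAt (fun s => ∫ x, A x * gaussLR (φ x) (Pi.single k s + y) ∂μ)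
      (∫ x, (A x * φ x k) * gaussLR (φ x) y ∂μ) 0 := by
  obtain ⟨B, hB0, hB⟩ := exists_ae_abs_le_of_memLp_top (hb k)
  have hAm := hA.1
  simp only [gaussLR_single_add]
  have := (hasDerivAt_integral_of_dominated_loc_of_deriv_le (μ := μ)
    (F := fun s x => A x * (gaussLR (φ x) y * Real.exp (s * φ x k)))
    (F' := fun s x => A x * (gaussLR (φ x) y * (φ x k * Real.exp (s * φ x k))))
    (x₀ := (0 : ℝ)) (bound := fun x => ‖A x * gaussLR (φ x) y‖ * (B * Real.exp B))
    (Metric.closedBall_mem_nhds _ one_pos)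
    (Filter.Eventually.of_forall fun s => hAm.mul (by fun_prop))
    (by simpa using integrable_mul_gaussLR hφ hb hA y)
    (hAm.mul (by fun_prop))
    (by
      filter_upwards [hB] with x hx s hs
      have hs' : |s| ≤ 1 := by simpa using hs
      rw [← mul_assoc, norm_mul]
      gcongr
      rw [norm_mul, Real.norm_eq_abs, Real.norm_eq_abs, abs_of_pos (Real.exp_pos _)]
      gcongr
      refine (le_abs_self _).trans ?_
      rw [abs_mul]
      nlinarith [abs_nonneg (φ x k)])
    ((integrable_mul_gaussLR hφ hb hA y).norm.mul_const _)
    (Filter.Eventually.of_forall fun x s _ => by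
      have hl : HasDerivAt (fun s => s * φ x k) (φ x k) s := by
        simpa using (hasDerivAt_id s).mul_const (φ x k)
      simpa [mul_comm (φ x k)] using (hl.exp.const_mul (gaussLR (φ x) y)).const_mul (A x))).2
  refine this.congr_deriv ?_
  refine integral_congr_ae (Filter.Eventually.of_forall fun x => ?_)
  simp only [zero_mul, Real.exp_zero]
  ring

lemma hasDerivAt_postMean [DecidableEq ι] (hφ : Measurable φ)
    (hb : ∀ k, MemLp (fun x => φ x k) ⊤ μ) {A : Ω → ℝ} (hA : MemLp A ⊤ μ) (y : ι → ℝ) (k : ι) :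
    HasDerivAt (fun s => postMean μ φ A (Pi.single k s + y))
      (postMean μ φ (fun x => A x * φ x k) y
        - postMean μ φ A y * postMean μ φ (fun x => φ x k) y) 0 := by
  have hpos := integral_gaussLR_signal_pos hφ hb y
  have h1 := hasDerivAt_integral_mul_gaussLR hφ hb hA y k
  have h2 := hasDerivAt_integral_mul_gaussLR hφ hb (memLp_const (1 : ℝ)) y k
  simp only [one_mul] at h2
  have h0 : (Pi.single k (0 : ℝ) : ι → ℝ) + y = y := by simp
  refine (h1.div h2 (by rw [h0]; exact hpos.ne')).congr_deriv ?_
  rw [h0]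
  simp only [postMean]
  field_simp

/-- Gaussian integration by parts for the posterior mean, for a fixed shift `c`. -/
lemma integral_eval_mul_postMean [DecidableEq ι] (hφ : Measurable φ)
    (hb : ∀ k, MemLp (fun x => φ x k) ⊤ μ) {A : Ω → ℝ} (hAm : Measurable A) (hA : MemLp A ⊤ μ)
    (c : ι → ℝ) (k : ι) :
    ∫ g, g k * postMean μ φ A (c + g) ∂stdGaussPi ι
      = ∫ g, (postMean μ φ (fun x => A x * φ x k) (c + g)
          - postMean μ φ A (c + g) * postMean μ φ (fun x => φ x k) (c + g)) ∂stdGaussPi ι := by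
  obtain ⟨C, hC0, hC⟩ := exists_ae_abs_le_of_memLp_top hA
  obtain ⟨D, hD0, hD⟩ := exists_ae_abs_le_of_memLp_top (hb k)
  obtain ⟨D', hD'0, hD'⟩ := exists_ae_abs_le_of_memLp_top (memLp_top_mul hA (hb k))
  have hm1 := measurable_postMean (μ := μ) hφ hAm
  have hm2 := measurable_postMean (μ := μ) hφ (A := fun x => φ x k) (by fun_prop)
  have hm3 := measurable_postMean (μ := μ) hφ (A := fun x => A x * φ x k) (by fun_prop)
  refine integral_eval_mul_stdGaussPi k (f := fun g => postMean μ φ A (c + g))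
    (C := C) (C' := D' + C * D) (by fun_prop) (by fun_prop)
    (fun g => abs_postMean_le hφ hb hC _) (fun g => ?_) (fun g => ?_)
  · refine (abs_sub _ _).trans (add_le_add (abs_postMean_le hφ hb hD' _) ?_)
    rw [abs_mul]
    exact mul_le_mul (abs_postMean_le hφ hb hC _) (abs_postMean_le hφ hb hD _) (abs_nonneg _) hC0
  · simp_rw [add_left_comm c]
    exact hasDerivAt_postMean hφ hb hA (c + g) k

lemma memLp_top_postMean (hφ : Measurable φ) (hb : ∀ k, MemLp (fun x => φ x k) ⊤ μ) {A : Ω → ℝ}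
    (hAm : Measurable A) (hA : MemLp A ⊤ μ) :
    MemLp (fun p : Ω × (ι → ℝ) => postMean μ φ A (φ p.1 + p.2)) ⊤ (signalNoise μ ι) := by
  obtain ⟨C, -, hC⟩ := exists_ae_abs_le_of_memLp_top hA
  have hm := measurable_postMean (μ := μ) hφ hAm
  exact memLp_top_of_bound (Measurable.aestronglyMeasurable (by fun_prop)) C
    (Filter.Eventually.of_forall fun p => abs_postMean_le hφ hb hC _)

lemma integrable_noise_mul {F : Ω × (ι → ℝ) → ℝ} (hF : MemLp F ⊤ (signalNoise μ ι)) (k : ι) :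
    Integrable (fun p => p.2 k * F p) (signalNoise μ ι) := by
  obtain ⟨C, -, hC⟩ := exists_ae_abs_le_of_memLp_top hF
  exact ((integrable_eval_stdGaussPi k).comp_snd μ).mul_bdd hF.1 hC

/-- Gaussian integration by parts under the joint law of signal and noise. -/
lemma integral_mul_noise_mul_postMean [DecidableEq ι] (hφ : Measurable φ)
    (hb : ∀ k, MemLp (fun x => φ x k) ⊤ μ) {a A : Ω → ℝ} (ha : MemLp a ⊤ μ) (hAm : Measurable A)
    (hA : MemLp A ⊤ μ) (k : ι) :
    ∫ p, p.2 k * (a p.1 * postMean μ φ A (φ p.1 + p.2)) ∂signalNoise μ ι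
      = ∫ p, a p.1 * (postMean μ φ (fun x => A x * φ x k) (φ p.1 + p.2)
          - postMean μ φ A (φ p.1 + p.2) * postMean μ φ (fun x => φ x k) (φ p.1 + p.2))
          ∂signalNoise μ ι := by
  have h1 := memLp_top_postMean hφ hb hAm hA
  have h2 := memLp_top_postMean hφ hb (A := fun x => φ x k) (by fun_prop) (hb k)
  have h3 := memLp_top_postMean hφ hb (A := fun x => A x * φ x k) (by fun_prop)
    (memLp_top_mul hA (hb k))
  have hfst := memLp_top_comp_fst (ι := ι) ha
  have hr := memLp_top_mul hfst (h3.sub (memLp_top_mul h1 h2))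
  simp only [Pi.sub_apply] at hr
  rw [integral_prod _ (integrable_noise_mul (memLp_top_mul hfst h1) k),
    integral_prod _ (hr.integrable le_top)]
  refine integral_congr_ae (Filter.Eventually.of_forall fun x => ?_)
  simp only
  rw [integral_const_mul, ← integral_eval_mul_postMean hφ hb hAm hA, ← integral_const_mul]
  simp only [mul_left_comm]

/-- Nishimori identity: the signal may be replaced by a sample from the posterior. -/
lemma integral_mul_eq_integral_postMean_mul (hφ : Measurable φ)
    (hb : ∀ k, MemLp (fun x => φ x k) ⊤ μ) {a : Ω → ℝ} (ham : Measurable a) (ha : MemLp a ⊤ μ)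
    {h : (ι → ℝ) → ℝ} (hm : Measurable h) (hC : ∃ C, ∀ y, |h y| ≤ C) :
    ∫ p, a p.1 * h (φ p.1 + p.2) ∂signalNoise μ ι
      = ∫ p, postMean μ φ a (φ p.1 + p.2) * h (φ p.1 + p.2) ∂signalNoise μ ι := by
  obtain ⟨C, hC⟩ := hC
  have hLR : Integrable (fun p : Ω × (ι → ℝ) => gaussLR (φ p.1) p.2) (signalNoise μ ι) := by
    rw [integrable_prod_iff (Measurable.aestronglyMeasurable (by fun_prop))]
    refine ⟨Filter.Eventually.of_forall fun x => integrable_gaussLR (φ x), ?_⟩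
    refine (integrable_const (1 : ℝ)).congr (Filter.Eventually.of_forall fun x => ?_)
    simp only [Real.norm_eq_abs, abs_of_pos (gaussLR_pos _ _), integral_gaussLR]
  have key : ∀ F : Ω × (ι → ℝ) → ℝ, Measurable F → MemLp F ⊤ (signalNoise μ ι) →
      MemLp (fun p => F (p.1, φ p.1 + p.2)) ⊤ (signalNoise μ ι) →
      ∫ p, F (p.1, φ p.1 + p.2) ∂signalNoise μ ι
        = ∫ y, ∫ x, F (x, y) * gaussLR (φ x) y ∂μ ∂stdGaussPi ι := by
    intro F hFm hF hF'
    obtain ⟨D, -, hD⟩ := exists_ae_abs_le_of_memLp_top hF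
    have hint : Integrable (fun p => F p * gaussLR (φ p.1) p.2) (signalNoise μ ι) :=
      hLR.bdd_mul hF.1 hD
    rw [← integral_prod_symm (fun p => F p * gaussLR (φ p.1) p.2) hint, integral_prod _ hint,
      integral_prod _ (hF'.integrable le_top)]
    refine integral_congr_ae (Filter.Eventually.of_forall fun x => ?_)
    exact integral_const_add_stdGaussPi (f := fun y => F (x, y)) (by fun_prop) (φ x)
  have hh : MemLp (fun p : Ω × (ι → ℝ) => h p.2) ⊤ (signalNoise μ ι) :=
    memLp_top_of_bound (Measurable.aestronglyMeasurable (by fun_prop)) C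
      (Filter.Eventually.of_forall fun p => hC _)
  have hh' : MemLp (fun p : Ω × (ι → ℝ) => h (φ p.1 + p.2)) ⊤ (signalNoise μ ι) :=
    memLp_top_of_bound (Measurable.aestronglyMeasurable (by fun_prop)) C
      (Filter.Eventually.of_forall fun p => hC _)
  obtain ⟨D, -, hD⟩ := exists_ae_abs_le_of_memLp_top ha
  have hpm := measurable_postMean (μ := μ) hφ ham
  have hp : MemLp (fun p : Ω × (ι → ℝ) => postMean μ φ a p.2) ⊤ (signalNoise μ ι) :=
    memLp_top_of_bound (Measurable.aestronglyMeasurable (by fun_prop)) D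
      (Filter.Eventually.of_forall fun p => abs_postMean_le hφ hb hD _)
  have hfst := memLp_top_comp_fst (ι := ι) ha
  rw [key (fun p => a p.1 * h p.2) (by fun_prop) (memLp_top_mul hfst hh) (memLp_top_mul hfst hh'),
    key (fun p => postMean μ φ a p.2 * h p.2) (by fun_prop) (memLp_top_mul hp hh)
      (memLp_top_mul (memLp_top_postMean hφ hb ham ha) hh')]
  refine integral_congr_ae (Filter.Eventually.of_forall fun y => ?_)
  simp only
  rw [integral_const_mul, postMean, mul_right_comm,
    div_mul_cancel₀ _ (integral_gaussLR_signal_pos hφ hb y).ne', ← integral_mul_const]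
  simp only [mul_right_comm]

end Posterior

section WignerSpike

variable {n : ℕ}

/-- Signal part of the observations in the interpolating Wigner spike model. -/
noncomputable def wignerSignal (n : ℕ) (t R : ℝ) (x : Fin n → ℝ) : (Fin n × Fin n) ⊕ Fin n → ℝ :=
  Sum.elim (fun p => if p.1 ≤ p.2 then Real.sqrt ((1 - t) / n) * (x p.1 * x p.2) else 0)
    (fun i => Real.sqrt R * x i)

lemma measurable_wignerSignal (t R : ℝ) : Measurable (wignerSignal n t R) := by
  refine measurable_pi_iff.2 fun k => ?_
  rcases k with p | i
  · simp only [wignerSignal, Sum.elim_inl]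
    split_ifs <;> fun_prop
  · simp only [wignerSignal, Sum.elim_inr]
    fun_prop

lemma exp_neg_Hint (hn : 1 ≤ n) {t R : ℝ} (ht : t ≤ 1) (hR : 0 < R) (X : Fin n → ℝ)
    (Z : Fin n × Fin n → ℝ) (Zt x : Fin n → ℝ) :
    Real.exp (-Hint n t R X Z Zt x)
      = gaussLR (wignerSignal n t R x) (wignerSignal n t R X + Sum.elim Z Zt) := by
  have hn0 : (0 : ℝ) < n := by exact_mod_cast hn
  have ht0 : 0 ≤ 1 - t := sub_nonneg.2 ht
  rw [gaussLR, Hint]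
  congr 1
  rw [Fintype.sum_sum_type, Fintype.sum_prod_type, neg_add, Finset.mul_sum, Finset.mul_sum,
    ← Finset.sum_neg_distrib, ← Finset.sum_neg_distrib]
  congr 1
  · refine Finset.sum_congr rfl fun i _ => ?_
    rw [Finset.sum_filter, Finset.mul_sum, ← Finset.sum_neg_distrib]
    refine Finset.sum_congr rfl fun j _ => ?_
    simp only [wignerSignal, Sum.elim_inl, Pi.add_apply]
    split_ifs with hij
    · set a := Real.sqrt ((1 - t) / n) with ha
      have ha2 : 1 - t = n * a ^ 2 := by
        rw [ha, Real.sq_sqrt (by positivity)]; field_simp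
      have hs : Real.sqrt (n * (1 - t)) = n * a := by
        rw [ha2, show (n : ℝ) * (n * a ^ 2) = (n * a) ^ 2 by ring, Real.sqrt_sq (by positivity)]
      rw [hs, ha2]
      rcases eq_or_ne a 0 with h0 | h0
      · simp [h0]
      · field_simp
        ring
    · simp
  · refine Finset.sum_congr rfl fun i _ => ?_
    simp only [wignerSignal, Sum.elim_inr, Pi.add_apply]
    have hsq := Real.sq_sqrt hR.le
    have hs : 0 < Real.sqrt R := Real.sqrt_pos.2 hR
    set s := Real.sqrt R
    rw [← hsq]
    field_simp
    ring

lemma gibbsWS_eq_postMean (P0 : Measure ℝ) (hn : 1 ≤ n) {t R : ℝ} (ht : t ≤ 1) (hR : 0 < R)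
    (X : Fin n → ℝ) (Z : Fin n × Fin n → ℝ) (Zt : Fin n → ℝ) (A : (Fin n → ℝ) → ℝ) :
    gibbsWS P0 n t R X Z Zt A
      = postMean (Measure.pi fun _ : Fin n => P0) (wignerSignal n t R) A
          (wignerSignal n t R X + Sum.elim Z Zt) := by
  simp only [gibbsWS, postMean, exp_neg_Hint hn ht hR]

variable {P0 : Measure ℝ} [IsProbabilityMeasure P0]

lemma EWS_eq_integral_signalNoise {F : (Fin n → ℝ) → (Fin n × Fin n → ℝ) → (Fin n → ℝ) → ℝ}
    {Φ : (Fin n → ℝ) × ((Fin n × Fin n) ⊕ Fin n → ℝ) → ℝ}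
    (hF : ∀ X Z Zt, F X Z Zt = Φ (X, Sum.elim Z Zt))
    (hΦ : Integrable Φ (signalNoise (Measure.pi fun _ : Fin n => P0) ((Fin n × Fin n) ⊕ Fin n))) :
    EWS P0 n F
      = ∫ p, Φ p ∂signalNoise (Measure.pi fun _ : Fin n => P0) ((Fin n × Fin n) ⊕ Fin n) := by
  have hmp := measurePreserving_sumPiEquivProdPi_symm
    (fun _ : (Fin n × Fin n) ⊕ Fin n => stdGauss)
  rw [EWS, integral_prod _ hΦ]
  refine integral_congr_ae ?_
  filter_upwards [hΦ.prod_right_ae] with X hX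
  have hXp := hmp.integrable_comp_of_integrable hX
  simp only [Function.comp_def] at hXp
  rw [← hmp.integral_comp', integral_prod _ hXp]
  refine integral_congr_ae (Filter.Eventually.of_forall fun Z => ?_)
  refine integral_congr_ae (Filter.Eventually.of_forall fun Zt => ?_)
  simp only [hF]
  congr 2

section Moments

variable {μ : Measure (Fin n → ℝ)} [IsProbabilityMeasure μ] {ι : Type*} [Fintype ι]
  {φ : (Fin n → ℝ) → ι → ℝ}

lemma postMean_Qws (hφ : Measurable φ) (hb : ∀ k, MemLp (fun x => φ x k) ⊤ μ)
    (hx : ∀ i, MemLp (fun x : Fin n → ℝ => x i) ⊤ μ) (X : Fin n → ℝ) (y : ι → ℝ) :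
    postMean μ φ (fun x => Qws n x X) y
      = 1 / n * ∑ i, X i * postMean μ φ (fun x => x i) y := by
  simp only [Qws]
  rw [postMean_const_mul, postMean_sum hφ hb _ fun i => (hx i).mul_const _]
  simp only [mul_comm _ (X _), postMean_const_mul]

lemma postMean_Lws (hφ : Measurable φ) (hb : ∀ k, MemLp (fun x => φ x k) ⊤ μ)
    (hx : ∀ i, MemLp (fun x : Fin n → ℝ => x i) ⊤ μ) (R : ℝ) (X Zt : Fin n → ℝ) (y : ι → ℝ) :
    postMean μ φ (fun x => Lws n R X Zt x) y
      = 1 / n * ∑ i, (1 / 2 * postMean μ φ (fun x => x i * x i) y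
          + -(X i + Zt i / (2 * Real.sqrt R)) * postMean μ φ (fun x => x i) y) := by
  have h : ∀ x : Fin n → ℝ, Lws n R X Zt x
      = 1 / n * ∑ i, (1 / 2 * (x i * x i) + -(X i + Zt i / (2 * Real.sqrt R)) * x i) := fun x => by
    rw [Lws]
    exact congrArg _ (Finset.sum_congr rfl fun i _ => by ring)
  simp only [h]
  have h2 : ∀ i, MemLp (fun x : Fin n → ℝ => 1 / 2 * (x i * x i)) ⊤ μ := fun i =>
    (memLp_top_mul (hx i) (hx i)).const_mul _
  have h1 : ∀ i, MemLp (fun x : Fin n → ℝ => -(X i + Zt i / (2 * Real.sqrt R)) * x i) ⊤ μ :=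
    fun i => (hx i).const_mul _
  rw [postMean_const_mul, postMean_sum hφ hb _ fun i => memLp_top_add (h2 i) (h1 i)]
  simp only [postMean_add hφ hb (h2 _) (h1 _), postMean_const_mul]

lemma postMean_Qws_mul_Lws_sub (hφ : Measurable φ) (hb : ∀ k, MemLp (fun x => φ x k) ⊤ μ)
    (hx : ∀ i, MemLp (fun x : Fin n → ℝ => x i) ⊤ μ) (R : ℝ) (X Zt : Fin n → ℝ) (l : ℝ)
    (y : ι → ℝ) :
    postMean μ φ (fun x => Qws n x X * (Lws n R X Zt x - l)) y
      = 1 / n * (1 / n) * ∑ q : Fin n × Fin n,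
          (1 / 2 * X q.1 * postMean μ φ (fun x => x q.1 * x q.2 * x q.2) y
            + -(X q.1 * X q.2 + Zt q.2 * X q.1 / (2 * Real.sqrt R))
              * postMean μ φ (fun x => x q.1 * x q.2) y)
        + -l * postMean μ φ (fun x => Qws n x X) y := by
  have h : ∀ x : Fin n → ℝ, Qws n x X * (Lws n R X Zt x - l)
      = 1 / n * (1 / n) * ∑ q : Fin n × Fin n, (1 / 2 * X q.1 * (x q.1 * x q.2 * x q.2)
          + -(X q.1 * X q.2 + Zt q.2 * X q.1 / (2 * Real.sqrt R)) * (x q.1 * x q.2))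
        + -l * Qws n x X := fun x => by
    rw [mul_sub, sub_eq_add_neg, mul_comm _ l, ← neg_mul]
    congr 1
    rw [Qws, Lws, mul_mul_mul_comm, Finset.sum_mul_sum, Fintype.sum_prod_type]
    exact congrArg _ (Finset.sum_congr rfl fun i _ => Finset.sum_congr rfl fun j _ => by ring)
  simp only [h]
  have h3 : ∀ q : Fin n × Fin n,
      MemLp (fun x : Fin n → ℝ => 1 / 2 * X q.1 * (x q.1 * x q.2 * x q.2)) ⊤ μ := fun q =>
    (memLp_top_mul (memLp_top_mul (hx _) (hx _)) (hx _)).const_mul _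
  have h2 : ∀ q : Fin n × Fin n, MemLp (fun x : Fin n → ℝ =>
      -(X q.1 * X q.2 + Zt q.2 * X q.1 / (2 * Real.sqrt R)) * (x q.1 * x q.2)) ⊤ μ := fun q =>
    (memLp_top_mul (hx _) (hx _)).const_mul _
  have hQ : MemLp (fun x => -l * Qws n x X) ⊤ μ :=
    ((memLp_finsetSum _ fun i _ => (hx i).mul_const _).const_mul _).const_mul _
  rw [postMean_add hφ hb ((memLp_finsetSum _ fun q _ => memLp_top_add (h3 q) (h2 q)).const_mul _)
      hQ, postMean_const_mul, postMean_const_mul,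
    postMean_sum hφ hb _ fun q => memLp_top_add (h3 q) (h2 q)]
  simp only [postMean_add hφ hb (h3 _) (h2 _), postMean_const_mul]

lemma postMean_Qws_sub_sq (hφ : Measurable φ) (hb : ∀ k, MemLp (fun x => φ x k) ⊤ μ)
    (hx : ∀ i, MemLp (fun x : Fin n → ℝ => x i) ⊤ μ) (X : Fin n → ℝ) (r : ℝ) (y : ι → ℝ) :
    postMean μ φ (fun x => (Qws n x X - r) ^ 2) y
      = 1 / n * (1 / n) * ∑ q : Fin n × Fin n,
          X q.1 * X q.2 * postMean μ φ (fun x => x q.1 * x q.2) y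
        + (-(2 * r) * postMean μ φ (fun x => Qws n x X) y + r ^ 2) := by
  have h : ∀ x : Fin n → ℝ, (Qws n x X - r) ^ 2
      = 1 / n * (1 / n) * ∑ q : Fin n × Fin n, X q.1 * X q.2 * (x q.1 * x q.2)
        + (-(2 * r) * Qws n x X + r ^ 2) := fun x => by
    have hsq : Qws n x X * Qws n x X
        = 1 / n * (1 / n) * ∑ q : Fin n × Fin n, X q.1 * X q.2 * (x q.1 * x q.2) := by
      rw [Qws, mul_mul_mul_comm, Finset.sum_mul_sum, Fintype.sum_prod_type]
      exact congrArg _ (Finset.sum_congr rfl fun i _ => Finset.sum_congr rfl fun j _ => by ring)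
    rw [← hsq]
    ring
  simp only [h]
  have h2 : ∀ q : Fin n × Fin n,
      MemLp (fun x : Fin n → ℝ => X q.1 * X q.2 * (x q.1 * x q.2)) ⊤ μ := fun q =>
    (memLp_top_mul (hx _) (hx _)).const_mul _
  have hQ : MemLp (fun x => -(2 * r) * Qws n x X) ⊤ μ :=
    ((memLp_finsetSum _ fun i _ => (hx i).mul_const _).const_mul _).const_mul _
  rw [postMean_add hφ hb ((memLp_finsetSum _ fun q _ => h2 q).const_mul _)
      (memLp_top_add hQ (memLp_const (r ^ 2))), postMean_add hφ hb hQ (memLp_const (r ^ 2)),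
    postMean_const hφ hb, postMean_const_mul, postMean_const_mul, postMean_sum hφ hb _ h2]
  simp only [postMean_const_mul]

end Moments

lemma memLp_top_eval_pi {S : ℝ} (hsupp : ∀ᵐ x ∂P0, x ∈ Set.Icc (-S) S) (i : Fin n) :
    MemLp (fun x : Fin n → ℝ => x i) ⊤ (Measure.pi fun _ : Fin n => P0) := by
  refine memLp_top_of_bound (measurable_pi_apply i).aestronglyMeasurable S ?_
  filter_upwards [(measurePreserving_eval (fun _ : Fin n => P0) i).quasiMeasurePreserving.ae hsupp]
    with x hx
  exact abs_le.2 hx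

lemma memLp_top_wignerSignal {μ : Measure (Fin n → ℝ)} [IsProbabilityMeasure μ]
    (hx : ∀ i, MemLp (fun x : Fin n → ℝ => x i) ⊤ μ) (t R : ℝ) (k : (Fin n × Fin n) ⊕ Fin n) :
    MemLp (fun x => wignerSignal n t R x k) ⊤ μ := by
  rcases k with p | i
  · simp only [wignerSignal, Sum.elim_inl]
    split_ifs
    · exact (memLp_top_mul (hx _) (hx _)).const_mul _
    · exact memLp_const 0
  · exact (hx i).const_mul _

lemma integrable_and_integral_energy_term {μ : Measure (Fin n → ℝ)} [IsProbabilityMeasure μ]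
    (hx : ∀ i, MemLp (fun x : Fin n → ℝ => x i) ⊤ μ) (t : ℝ) {R : ℝ} (hR : 0 < R)
    {a A : (Fin n → ℝ) → ℝ} (ha : MemLp a ⊤ μ) (hAm : Measurable A) (hA : MemLp A ⊤ μ)
    (i : Fin n) :
    let φ := wignerSignal n t R
    let P := signalNoise μ ((Fin n × Fin n) ⊕ Fin n)
    let T := fun p : (Fin n → ℝ) × ((Fin n × Fin n) ⊕ Fin n → ℝ) =>
      1 / 2 * a p.1 * postMean μ φ (fun x => A x * x i) (φ p.1 + p.2)
        + -(a p.1 * p.1 i + p.2 (Sum.inr i) * a p.1 / (2 * Real.sqrt R))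
          * postMean μ φ A (φ p.1 + p.2)
    Integrable T P ∧
      ∫ p, T p ∂P = -(∫ p, a p.1 * p.1 i * postMean μ φ A (φ p.1 + p.2) ∂P)
        + 1 / 2 * ∫ p, a p.1 * (postMean μ φ A (φ p.1 + p.2)
            * postMean μ φ (fun x => x i) (φ p.1 + p.2)) ∂P := by
  intro φ P T
  have hφ : Measurable φ := measurable_wignerSignal t R
  have hb := memLp_top_wignerSignal hx t R
  have hs : Real.sqrt R ≠ 0 := (Real.sqrt_pos.2 hR).ne'
  have hfst := memLp_top_comp_fst (ι := (Fin n × Fin n) ⊕ Fin n) ha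
  have hfsti := memLp_top_comp_fst (ι := (Fin n × Fin n) ⊕ Fin n) (hx i)
  have hmA := memLp_top_postMean hφ hb hAm hA
  have hmi := memLp_top_postMean hφ hb (measurable_pi_apply i) (hx i)
  have hmAi := memLp_top_postMean (A := fun x => A x * x i) hφ hb
    (hAm.mul (measurable_pi_apply i)) (memLp_top_mul hA (hx i))
  have i1 := (memLp_top_mul hfst hmAi).integrable le_top
  have i2 := (memLp_top_mul (memLp_top_mul hfst hfsti) hmA).integrable le_top
  have i3 := integrable_noise_mul (memLp_top_mul hfst hmA) (Sum.inr i)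
  have i4 := (memLp_top_mul hfst (memLp_top_mul hmA hmi)).integrable le_top
  have hT : T = fun p => 1 / 2 * (a p.1 * postMean μ φ (fun x => A x * x i) (φ p.1 + p.2))
      - a p.1 * p.1 i * postMean μ φ A (φ p.1 + p.2)
      - 1 / (2 * Real.sqrt R)
        * (p.2 (Sum.inr i) * (a p.1 * postMean μ φ A (φ p.1 + p.2))) := by
    ext p
    simp only [T]
    ring
  have hibp := integral_mul_noise_mul_postMean hφ hb ha hAm hA (Sum.inr i)
  have hinr : ∀ x, φ x (Sum.inr i) = Real.sqrt R * x i := fun x => rfl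
  simp only [hinr, mul_left_comm _ (Real.sqrt R), postMean_const_mul, ← mul_sub] at hibp
  rw [integral_const_mul] at hibp
  simp only [mul_sub] at hibp
  rw [integral_sub i1 i4] at hibp
  rw [hT]
  refine ⟨((i1.const_mul _).sub i2).sub (i3.const_mul _), ?_⟩
  refine (integral_sub ((i1.const_mul _).sub i2) (i3.const_mul _)).trans ?_
  refine (congrArg (· - _) (integral_sub (i1.const_mul _) i2)).trans ?_
  simp only [integral_const_mul, P]
  rw [hibp]
  field_simp
  ring

end WignerSpike

/-- Overlap–`L` fluctuation identity for the interpolating Wigner spike model: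
`-2 E⟨Q(L - E⟨L⟩)⟩ = E⟨(Q - E⟨Q⟩)²⟩ + E⟨(Q - ⟨Q⟩)²⟩`. -/
theorem wignerSpike_overlap_L_identity (S : ℝ) (hS : 0 < S)
    (P0 : Measure ℝ) [IsProbabilityMeasure P0]
    (hsupp : ∀ᵐ x ∂P0, x ∈ Set.Icc (-S) S)
    (n : ℕ) (hn : 1 ≤ n) (t : ℝ) (ht : t ∈ Set.Icc (0 : ℝ) 1)
    (R : ℝ) (hR : 0 < R) :
    -2 * EWS P0 n (fun X Z Zt => gibbsWS P0 n t R X Z Zt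
          (fun x => Qws n x X * (Lws n R X Zt x - ELws P0 n t R)))
      = EWS P0 n (fun X Z Zt => gibbsWS P0 n t R X Z Zt
            (fun x => (Qws n x X - EQws P0 n t R) ^ 2))
        + EWS P0 n (fun X Z Zt => gibbsWS P0 n t R X Z Zt
            (fun x => (Qws n x X - gibbsWS P0 n t R X Z Zt (fun x' => Qws n x' X)) ^ 2)) := by
  have hx := fun i => memLp_top_eval_pi (n := n) hsupp i
  set μ : Measure (Fin n → ℝ) := Measure.pi fun _ : Fin n => P0 with hμ
  set φ := wignerSignal n t R with hφdef
  set P := signalNoise μ ((Fin n × Fin n) ⊕ Fin n) with hP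
  have hφ : Measurable φ := measurable_wignerSignal t R
  have hb : ∀ k, MemLp (fun x => φ x k) ⊤ μ := memLp_top_wignerSignal hx t R
  have hgibbs := gibbsWS_eq_postMean P0 hn ht.2 hR
  have hxx : ∀ q : Fin n × Fin n, MemLp (fun x : Fin n → ℝ => x q.1 * x q.2) ⊤ μ := fun q =>
    memLp_top_mul (hx _) (hx _)
  have hxxm : ∀ q : Fin n × Fin n, Measurable fun x : Fin n → ℝ => x q.1 * x q.2 := fun q => by
    fun_prop
  set m : Fin n → (((Fin n × Fin n) ⊕ Fin n) → ℝ) → ℝ := fun i =>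
    postMean μ φ (fun x => x i) with hm
  set m₂ : Fin n × Fin n → (((Fin n × Fin n) ⊕ Fin n) → ℝ) → ℝ := fun q =>
    postMean μ φ (fun x => x q.1 * x q.2) with hm₂
  have mm : ∀ i, Measurable (m i) := fun i => measurable_postMean hφ (measurable_pi_apply i)
  have mm₂ : ∀ q, Measurable (m₂ q) := fun q => measurable_postMean hφ (hxxm q)
  have bm : ∀ i, ∃ C, ∀ y, |m i y| ≤ C := fun i => exists_abs_postMean_le hφ hb (hx i)
  have bm₂ : ∀ q, ∃ C, ∀ y, |m₂ q y| ≤ C := fun q => exists_abs_postMean_le hφ hb (hxx q)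
  have lX : ∀ i, MemLp (fun p : (Fin n → ℝ) × ((Fin n × Fin n) ⊕ Fin n → ℝ) => p.1 i) ⊤ P :=
    fun i => memLp_top_comp_fst (hx i)
  have lm : ∀ i, MemLp (fun p => m i (φ p.1 + p.2)) ⊤ P := fun i =>
    memLp_top_postMean hφ hb (measurable_pi_apply i) (hx i)
  have lm₂ : ∀ q, MemLp (fun p => m₂ q (φ p.1 + p.2)) ⊤ P := fun q =>
    memLp_top_postMean hφ hb (hxxm q) (hxx q)
  set N : Fin n → ℝ := fun i => ∫ p, m i (φ p.1 + p.2) * m i (φ p.1 + p.2) ∂P with hN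
  set M : Fin n × Fin n → ℝ := fun q => ∫ p, m₂ q (φ p.1 + p.2) * m₂ q (φ p.1 + p.2) ∂P with hM
  set K : Fin n × Fin n → ℝ := fun q =>
    ∫ p, m₂ q (φ p.1 + p.2) * (m q.1 (φ p.1 + p.2) * m q.2 (φ p.1 + p.2)) ∂P with hK
  have nishN : ∀ i, ∫ p, p.1 i * m i (φ p.1 + p.2) ∂P = N i := fun i =>
    integral_mul_eq_integral_postMean_mul hφ hb (measurable_pi_apply i) (hx i) (mm i) (bm i)
  have nishM : ∀ q : Fin n × Fin n, ∫ p, p.1 q.1 * p.1 q.2 * m₂ q (φ p.1 + p.2) ∂P = M q :=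
    fun q => integral_mul_eq_integral_postMean_mul hφ hb (hxxm q) (hxx q) (mm₂ q) (bm₂ q)
  have nishK : ∀ q : Fin n × Fin n,
      ∫ p, p.1 q.1 * p.1 q.2 * (m q.1 (φ p.1 + p.2) * m q.2 (φ p.1 + p.2)) ∂P = K q := fun q =>
    integral_mul_eq_integral_postMean_mul hφ hb (hxxm q) (hxx q)
      (h := fun y => m q.1 y * m q.2 y) ((mm _).mul (mm _)) (exists_abs_mul_le (bm _) (bm _))
  have nishK' : ∀ q : Fin n × Fin n,
      ∫ p, p.1 q.1 * (m₂ q (φ p.1 + p.2) * m q.2 (φ p.1 + p.2)) ∂P = K q := fun q => by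
    refine (integral_mul_eq_integral_postMean_mul hφ hb (measurable_pi_apply q.1) (hx q.1)
      (h := fun y => m₂ q y * m q.2 y) ((mm₂ _).mul (mm _))
      (exists_abs_mul_le (bm₂ _) (bm _))).trans ?_
    exact integral_congr_ae (Filter.Eventually.of_forall fun p => mul_left_comm _ _ _)
  have energy₁ := fun i : Fin n =>
    integrable_and_integral_energy_term hx t hR (a := fun _ => 1) (memLp_const 1)
      (measurable_pi_apply i) (hx i) i
  have energy₂ := fun q : Fin n × Fin n =>
    integrable_and_integral_energy_term hx t hR (hx q.1) (hxxm q) (hxx q) q.2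
  simp only [one_mul, mul_one] at energy₁
  -- the quenched overlap
  have iXm : ∀ i, Integrable (fun p => p.1 i * m i (φ p.1 + p.2)) P := fun i =>
    (memLp_top_mul (lX i) (lm i)).integrable le_top
  have iQ : Integrable (fun p => 1 / (n : ℝ) * ∑ i, p.1 i * m i (φ p.1 + p.2)) P :=
    (integrable_finsetSum _ fun i _ => iXm i).const_mul _
  have eQ : ∫ p, 1 / (n : ℝ) * ∑ i, p.1 i * m i (φ p.1 + p.2) ∂P = 1 / n * ∑ i, N i := by
    rw [integral_const_mul, integral_finsetSum _ fun i _ => iXm i]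
    simp only [nishN]
  have hQ₀ : EQws P0 n t R = 1 / n * ∑ i, N i := by
    rw [← eQ, EQws]
    refine EWS_eq_integral_signalNoise (fun X Z Zt => ?_) iQ
    rw [hgibbs, postMean_Qws hφ hb hx]
  -- the quenched energy
  have hL₀ : ELws P0 n t R = 1 / n * ∑ i, (-(1 / 2) * N i) := by
    have hT := (integrable_finsetSum Finset.univ fun i _ => (energy₁ i).1).const_mul (1 / (n : ℝ))
    rw [ELws, EWS_eq_integral_signalNoise (fun X Z Zt => ?_) hT]
    · rw [integral_const_mul, integral_finsetSum _ fun i _ => (energy₁ i).1]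
      refine congrArg _ (Finset.sum_congr rfl fun i _ => ?_)
      rw [(energy₁ i).2]
      have h1 := nishN i
      simp only [hN, hm] at h1 ⊢
      rw [h1]
      ring
    · rw [hgibbs, postMean_Lws hφ hb hx]
      rfl
  set Q₀ := EQws P0 n t R
  set L₀ := ELws P0 n t R
  -- the correlation of overlap and energy
  have hQL : EWS P0 n (fun X Z Zt => gibbsWS P0 n t R X Z Zt
      (fun x => Qws n x X * (Lws n R X Zt x - L₀)))
      = 1 / n * (1 / n) * ∑ q, (-M q + 1 / 2 * K q) + -L₀ * Q₀ := by
    have hT := (integrable_finsetSum Finset.univ fun q _ => (energy₂ q).1).const_mul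
      (1 / (n : ℝ) * (1 / n))
    rw [EWS_eq_integral_signalNoise (fun X Z Zt => ?_) (hT.add (iQ.const_mul (-L₀)))]
    · simp only [Pi.add_apply]
      rw [integral_add hT (iQ.const_mul _), integral_const_mul, integral_const_mul, eQ, ← hQ₀,
        integral_finsetSum _ fun q _ => (energy₂ q).1]
      congr 2
      refine Finset.sum_congr rfl fun q _ => ?_
      rw [(energy₂ q).2]
      exact congrArg₂ _ (congrArg _ (nishM q)) (congrArg _ (nishK' q))
    · rw [hgibbs, postMean_Qws_mul_Lws_sub hφ hb hx, postMean_Qws hφ hb hx]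
      rfl
  -- the two overlap fluctuations
  have iQQ : ∀ q : Fin n × Fin n, Integrable (fun p => p.1 q.1 * p.1 q.2 * m₂ q (φ p.1 + p.2)) P :=
    fun q => (memLp_top_mul (memLp_top_mul (lX _) (lX _)) (lm₂ q)).integrable le_top
  have iS := (integrable_finsetSum Finset.univ fun q _ => iQQ q).const_mul (1 / (n : ℝ) * (1 / n))
  have eS : ∫ p, 1 / (n : ℝ) * (1 / n) * ∑ q : Fin n × Fin n,
      p.1 q.1 * p.1 q.2 * m₂ q (φ p.1 + p.2) ∂P = 1 / n * (1 / n) * ∑ q, M q := by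
    rw [integral_const_mul, integral_finsetSum _ fun q _ => iQQ q]
    simp only [nishM]
  have hV : EWS P0 n (fun X Z Zt => gibbsWS P0 n t R X Z Zt (fun x => (Qws n x X - Q₀) ^ 2))
      = 1 / n * (1 / n) * ∑ q, M q + (-(2 * Q₀) * Q₀ + Q₀ ^ 2) := by
    have iR := (iQ.const_mul (-(2 * Q₀))).add (integrable_const (Q₀ ^ 2))
    rw [EWS_eq_integral_signalNoise (fun X Z Zt => ?_) (iS.add iR)]
    · refine (integral_add iS iR).trans ?_
      refine (congrArg (_ + ·) (integral_add (iQ.const_mul _) (integrable_const _))).trans ?_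
      rw [eS, integral_const_mul, eQ, ← hQ₀]
      simp
    · rw [hgibbs, postMean_Qws_sub_sq hφ hb hx, postMean_Qws hφ hb hx]
      rfl
  have iK : ∀ q : Fin n × Fin n, Integrable (fun p =>
      p.1 q.1 * p.1 q.2 * (m q.1 (φ p.1 + p.2) * m q.2 (φ p.1 + p.2))) P := fun q =>
    (memLp_top_mul (memLp_top_mul (lX _) (lX _)) (memLp_top_mul (lm _) (lm _))).integrable le_top
  have hW : EWS P0 n (fun X Z Zt => gibbsWS P0 n t R X Z Zt
      (fun x => (Qws n x X - gibbsWS P0 n t R X Z Zt (fun x' => Qws n x' X)) ^ 2))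
      = 1 / n * (1 / n) * ∑ q, M q - 1 / n * (1 / n) * ∑ q, K q := by
    have iR := (integrable_finsetSum Finset.univ fun q _ => iK q).const_mul
      (1 / (n : ℝ) * (1 / n))
    rw [EWS_eq_integral_signalNoise (fun X Z Zt => ?_) (iS.sub iR)]
    · simp only [Pi.sub_apply]
      rw [integral_sub iS iR, eS, integral_const_mul, integral_finsetSum _ fun q _ => iK q]
      simp only [nishK]
    · rw [hgibbs, postMean_Qws_sub_sq hφ hb hx, hgibbs, sub_eq_add_neg]
      refine congrArg₂ _ rfl ?_
      have hsq : ∑ q : Fin n × Fin n, X q.1 * X q.2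
          * (m q.1 (φ X + Sum.elim Z Zt) * m q.2 (φ X + Sum.elim Z Zt))
          = (∑ i, X i * m i (φ X + Sum.elim Z Zt)) * ∑ i, X i * m i (φ X + Sum.elim Z Zt) := by
        rw [Finset.sum_mul_sum, Fintype.sum_prod_type]
        exact Finset.sum_congr rfl fun i _ => Finset.sum_congr rfl fun j _ => by ring
      simp only [Pi.neg_apply]
      rw [hsq, postMean_Qws hφ hb hx]
      simp only [hm, hφdef]
      ring
  rw [hQL, hV, hW, hL₀, ← Finset.mul_sum, mul_left_comm (1 / (n : ℝ)), ← hQ₀,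
    Finset.sum_add_distrib, Finset.sum_neg_distrib, ← Finset.mul_sum]
  ring
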